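/- Let 𝒜 be an ℓ-arrangement whose logarithmic derivation module D(𝒜) has a homogeneous generating set θ_E, θ₁, …, θ_s, φ₁, …, φ_{ℓ−k−1} with deg θᵢ = dᵢ ≤ d_{i+1} ≤ e_j := deg φ_j for all i, j. Let X ∈ L_k(𝒜) satisfy |𝒜^X| = 1 + Σ_{i=1}^{ℓ−k−1} eᵢ. Then 𝒜^X is free with exponents (1, e₁, …, e_{ℓ−k−1}). -/

import Mathlib

open MvPolynomial Module

attribute [local instance] Classical.propDecidable

namespace ArrPaper

variable {K : Type*} [Field K] {ℓ m : ℕ}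

/-- The polynomial coordinate ring `S = K[x₁,…,x_ℓ]`. -/
abbrev S (K : Type*) [Field K] (ℓ : ℕ) := MvPolynomial (Fin ℓ) K

/-- A polynomial derivation of `S`, given by its values on the variables. -/
abbrev Deriv (K : Type*) [Field K] (ℓ : ℕ) := Fin ℓ → S K ℓ

/-- The linear form `∑ αᵢ xᵢ` as a polynomial. -/
noncomputable def lin (α : Fin ℓ → K) : S K ℓ := ∑ i, C (α i) * X i

/-- The value `θ(α)` of a derivation on a linear form `α`. -/
noncomputable def applyD (θ : Deriv K ℓ) (α : Fin ℓ → K) : S K ℓ := ∑ i, C (α i) * θ i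

lemma applyD_add (θ η : Deriv K ℓ) (α : Fin ℓ → K) :
    applyD (θ + η) α = applyD θ α + applyD η α := by
  simp [applyD, mul_add, Finset.sum_add_distrib]

lemma applyD_smul (f : S K ℓ) (θ : Deriv K ℓ) (α : Fin ℓ → K) :
    applyD (f • θ) α = f * applyD θ α := by
  simp only [applyD, Pi.smul_apply, smul_eq_mul, Finset.mul_sum]
  exact Finset.sum_congr rfl fun i _ => by ring

/-- The logarithmic derivation module `D(𝒜)` of an arrangement, where the
arrangement is specified by the finite set of its defining linear forms. -/
noncomputable def logDer (A : Finset (Fin ℓ → K)) : Submodule (S K ℓ) (Deriv K ℓ) where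
  carrier := {θ | ∀ α ∈ A, lin α ∣ applyD θ α}
  add_mem' := by
    intro a b ha hb α hα
    rw [applyD_add]
    exact dvd_add (ha α hα) (hb α hα)
  zero_mem' := by intro α hα; simp [applyD]
  smul_mem' := by
    intro f θ hθ β hβ
    rw [applyD_smul]
    exact (hθ β hβ).mul_left f

/-- The logarithmic derivation module `D(𝒜, m)` of a multiarrangement. -/
noncomputable def logDerM (A : Finset (Fin ℓ → K)) (mult : (Fin ℓ → K) → ℕ) :
    Submodule (S K ℓ) (Deriv K ℓ) where
  carrier := {θ | ∀ α ∈ A, (lin α) ^ (mult α) ∣ applyD θ α}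
  add_mem' := by
    intro a b ha hb α hα
    rw [applyD_add]
    exact dvd_add (ha α hα) (hb α hα)
  zero_mem' := by intro α hα; simp [applyD]
  smul_mem' := by
    intro f θ hθ β hβ
    rw [applyD_smul]
    exact (hθ β hβ).mul_left f

/-- The Euler derivation. -/
noncomputable def eulerD (K : Type*) [Field K] (ℓ : ℕ) : Deriv K ℓ := fun i => X i

/-- A derivation is homogeneous of degree `d` if all its coefficients are. -/
def IsHomog (θ : Deriv K ℓ) (d : ℕ) : Prop := ∀ i, (θ i).IsHomogeneous d

/-- A family is a (free) basis of a submodule of the derivation module. -/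
def IsBasisOf {ι : Type*} (θ : ι → Deriv K ℓ) (M : Submodule (S K ℓ) (Deriv K ℓ)) : Prop :=
  (∀ i, θ i ∈ M) ∧ LinearIndependent (S K ℓ) θ ∧ Submodule.span (S K ℓ) (Set.range θ) = M

/-- `𝒜` is free with exponents `d₁,…,d_ℓ`. -/
def IsFreeWithExp (A : Finset (Fin ℓ → K)) (d : Fin ℓ → ℕ) : Prop :=
  ∃ θ : Fin ℓ → Deriv K ℓ, IsBasisOf θ (logDer A) ∧ ∀ i, IsHomog (θ i) (d i)

/-- `(𝒜, m)` is free with exponents `d₁,…,d_ℓ`. -/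
def IsFreeWithExpM (A : Finset (Fin ℓ → K)) (mult : (Fin ℓ → K) → ℕ) (d : Fin ℓ → ℕ) : Prop :=
  ∃ θ : Fin ℓ → Deriv K ℓ, IsBasisOf θ (logDerM A mult) ∧ ∀ i, IsHomog (θ i) (d i)

/-- The hyperplane `ker α ⊆ Kˡ` attached to a linear form `α`. -/
noncomputable def hyp (α : Fin ℓ → K) : Submodule K (Fin ℓ → K) :=
  LinearMap.ker (∑ i, α i • LinearMap.proj i : (Fin ℓ → K) →ₗ[K] K)

/-- The restriction `𝒜^H = {H ∩ L : L ∈ 𝒜'}` of an arrangement `𝒜'` to the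
hyperplane `H = ker α_H`, as a finite set of subspaces. -/
noncomputable def restH (A' : Finset (Fin ℓ → K)) (αH : Fin ℓ → K) :
    Finset (Submodule K (Fin ℓ → K)) :=
  A'.image (fun β => hyp αH ⊓ hyp β)

/-- The restriction `𝒜^X = {X ∩ H : H ∈ 𝒜, X ⊄ H}` to a subspace `X`. -/
noncomputable def restArr (A : Finset (Fin ℓ → K)) (Xs : Submodule K (Fin ℓ → K)) :
    Finset (Submodule K (Fin ℓ → K)) :=
  (A.filter (fun β => ¬ Xs ≤ hyp β)).image (fun β => Xs ⊓ hyp β)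

/-- Codimension of a subspace of `Kˡ`. -/
noncomputable def codim (Xs : Submodule K (Fin ℓ → K)) : ℕ := ℓ - Module.finrank K Xs

/-- The intersection lattice `L(𝒜)`. -/
noncomputable def LSet (A : Finset (Fin ℓ → K)) : Finset (Submodule K (Fin ℓ → K)) :=
  A.powerset.image (fun b => b.inf hyp)

/-- Pullback (restriction) of polynomial functions along a linear map
`ι : Kᵐ → Kˡ`. -/
noncomputable def pullback (ι : (Fin m → K) →ₗ[K] (Fin ℓ → K)) : S K ℓ →ₐ[K] S K m :=
  aeval (fun j => ∑ i, C (ι (Pi.single i 1) j) * X i)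

/-- The (Euler) restriction of a derivation onto the subspace `im ι ≅ Kᵐ`,
computed using chosen linear forms `γ i` lifting the coordinates of `Kᵐ`. -/
noncomputable def restD (ι : (Fin m → K) →ₗ[K] (Fin ℓ → K)) (γ : Fin m → (Fin ℓ → K))
    (θ : Deriv K ℓ) : Deriv K m :=
  fun i => pullback ι (applyD θ (γ i))

/-- `γ` is a system of coordinate lifts for `ι : Kᵐ → Kˡ`. -/
def CoordLifts (ι : (Fin m → K) →ₗ[K] (Fin ℓ → K)) (γ : Fin m → (Fin ℓ → K)) : Prop :=
  ∀ i, pullback ι (lin (γ i)) = X i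

/-- `B` (a finite set of forms on `Kᵐ`) represents the restricted arrangement
`𝒜^X` via the embedding `ι : Kᵐ ≅ X ⊆ Kˡ`. -/
def Represents (B : Finset (Fin m → K)) (ι : (Fin m → K) →ₗ[K] (Fin ℓ → K))
    (A : Finset (Fin ℓ → K)) (Xs : Submodule K (Fin ℓ → K)) : Prop :=
  (∀ b ∈ B, b ≠ 0) ∧ B.image (fun b => (hyp b).map ι) = restArr A Xs ∧
    B.card = (restArr A Xs).card

/-- The restricted arrangement `𝒜^X` is free with exponents `e`. -/
def RestFree (A : Finset (Fin ℓ → K)) (Xs : Submodule K (Fin ℓ → K)) (m : ℕ)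
    (e : Fin m → ℕ) : Prop :=
  ∃ (φ : (Fin m → K) ≃ₗ[K] Xs) (B : Finset (Fin m → K)),
    Represents B (Xs.subtype ∘ₗ φ.toLinearMap) A Xs ∧ IsFreeWithExp B e

/-- The Ziegler multiplicity of a hyperplane `ker b ⊆ Kᵐ ≅ H` obtained by
restricting `𝒜` onto `H = ker α_H`. -/
noncomputable def zMult (A : Finset (Fin ℓ → K)) (αH : Fin ℓ → K)
    (ι : (Fin m → K) →ₗ[K] (Fin ℓ → K)) (b : Fin m → K) : ℕ :=
  ((A.erase αH).filter (fun β => hyp αH ⊓ hyp β = (hyp b).map ι)).card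

/-- `θ ↦ θ(α)` as an `S`-linear map. -/
noncomputable def applyDL (α : Fin ℓ → K) : Deriv K ℓ →ₗ[S K ℓ] S K ℓ where
  toFun θ := applyD θ α
  map_add' a b := applyD_add a b α
  map_smul' f θ := by simpa using applyD_smul f θ α

/-- `D_H(𝒜) = {θ ∈ D(𝒜) : θ(α_H) = 0}`. -/
noncomputable def DH (A : Finset (Fin ℓ → K)) (αH : Fin ℓ → K) :
    Submodule (S K ℓ) (Deriv K ℓ) :=
  logDer A ⊓ LinearMap.ker (applyDL αH)

end ArrPaper


namespace ArrPaper

section Saito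
variable {K : Type*} [Field K] {m : ℕ}

lemma mem_hyp (α v : Fin m → K) : v ∈ hyp α ↔ ∑ i, α i * v i = 0 := by
  simp [hyp]

lemma eval_lin (α v : Fin m → K) : eval v (lin α) = ∑ i, α i * v i := by
  simp [lin]

lemma lin_homog (α : Fin m → K) : (lin α).IsHomogeneous 1 := by
  unfold lin
  exact IsHomogeneous.sum _ _ _ fun i _ => isHomogeneous_C_mul_X _ _

lemma coeff_lin (α : Fin m → K) (i : Fin m) : coeff (Finsupp.single i 1) (lin α) = α i := by
  simp [lin, coeff_sum, coeff_C_mul, coeff_X, Finsupp.single_left_inj]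

lemma lin_ne_zero {α : Fin m → K} (h : α ≠ 0) : lin α ≠ 0 := by
  intro h0
  apply h
  ext i
  rw [← coeff_lin α i, h0]; simp

lemma lin_irred {α : Fin m → K} (h : α ≠ 0) : Irreducible (lin α) := by
  apply irreducible_of_totalDegree_eq_one
  · exact (lin_homog α).totalDegree (lin_ne_zero h)
  · intro x hx
    rw [isUnit_iff_ne_zero]
    rintro rfl
    apply h
    ext i
    have := hx (Finsupp.single i 1)
    rw [coeff_lin] at this
    simpa using this

lemma hyp_le_of_dvd {a b : Fin m → K} (h : lin a ∣ lin b) : hyp a ≤ hyp b := by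
  intro v hv
  rw [mem_hyp, ← eval_lin] at *
  obtain ⟨c, hc⟩ := h
  rw [hc]; simp [hv]

lemma lin_dvd_det {b : Fin m → K} (hb : b ≠ 0) (η : Fin m → Deriv K m)
    (h : ∀ j, lin b ∣ applyD (η j) b) :
    lin b ∣ (Matrix.of fun i j => η j i : Matrix (Fin m) (Fin m) (S K m)).det := by
  set M := (Matrix.of fun i j => η i j : Matrix (Fin m) (Fin m) (S K m)) with hM
  have hT : (Matrix.of fun i j => η j i : Matrix (Fin m) (Fin m) (S K m)) = M.transpose := by
    ext; simp [hM]
  rw [hT, Matrix.det_transpose]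
  choose c hc using h
  have h1 : M.mulVec (fun i => C (b i)) = lin b • c := by
    ext1 j
    simp only [Matrix.mulVec, dotProduct, hM, Matrix.of_apply, Pi.smul_apply, smul_eq_mul, ← hc]
    simp only [applyD]
    exact Finset.sum_congr rfl fun i _ => mul_comm _ _
  have h2 : M.det • (fun i => (C (b i) : S K m)) = lin b • (M.adjugate.mulVec c) := by
    rw [← Matrix.mulVec_smul, ← h1, Matrix.mulVec_mulVec, Matrix.adjugate_mul, Matrix.smul_mulVec,
      Matrix.one_mulVec]
  obtain ⟨i, hi⟩ : ∃ i, b i ≠ 0 := by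
    by_contra hcon
    push Not at hcon
    exact hb (funext hcon)
  have h3 := congrFun h2 i
  simp only [Pi.smul_apply, smul_eq_mul] at h3
  have h4 : lin b ∣ M.det * C (b i) := ⟨_, h3⟩
  have hu : IsUnit (C (b i) : S K m) := (isUnit_iff_ne_zero.mpr hi).map C
  exact (hu.dvd_mul_right).mp h4

lemma prod_dvd_det {B : Finset (Fin m → K)} (hB : ∀ b ∈ B, b ≠ 0)
    (hinj : ∀ b ∈ B, ∀ b' ∈ B, hyp b = hyp b' → b = b') (η : Fin m → Deriv K m)
    (h : ∀ j, η j ∈ logDer B) :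
    (∏ b ∈ B, lin b) ∣ (Matrix.of fun i j => η j i : Matrix (Fin m) (Fin m) (S K m)).det := by
  apply Finset.prod_dvd_of_isRelPrime
  · intro a ha b hb hab
    have ha' := lin_irred (hB a ha)
    have hb' := lin_irred (hB b hb)
    show IsRelPrime _ _
    rw [ha'.isRelPrime_iff_not_dvd]
    intro hd
    exact hab (hinj a ha b hb (le_antisymm (hyp_le_of_dvd hd)
      (hyp_le_of_dvd (ha'.dvd_symm hb' hd))))
  · intro b hb
    exact lin_dvd_det (hB b hb) η fun j => h j b hb

/-- Saito's criterion, with the degree count. -/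
lemma saito {B : Finset (Fin m → K)} (hB : ∀ b ∈ B, b ≠ 0)
    (hinj : ∀ b ∈ B, ∀ b' ∈ B, hyp b = hyp b' → b = b') (η : Fin m → Deriv K m)
    (h : ∀ j, η j ∈ logDer B) (d : Fin m → ℕ) (hd : ∀ j, IsHomog (η j) (d j))
    (hdet : (Matrix.of fun i j => η j i : Matrix (Fin m) (Fin m) (S K m)).det ≠ 0)
    (hdeg : ∑ j, d j ≤ B.card) :
    ∑ j, d j = B.card ∧ IsBasisOf η (logDer B) := by
  set M := (Matrix.of fun i j => η j i : Matrix (Fin m) (Fin m) (S K m)) with hM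
  obtain ⟨c, hc⟩ := prod_dvd_det hB hinj η h
  rw [← hM] at hc
  set Q := ∏ b ∈ B, lin b with hQ
  have hQ0 : Q ≠ 0 := by rintro h0; apply hdet; rw [hc, h0, zero_mul]
  have hc0 : c ≠ 0 := by rintro h0; apply hdet; rw [hc, h0, mul_zero]
  have hQh : Q.IsHomogeneous B.card := by
    have := IsHomogeneous.prod B (fun b => lin b) (fun _ => 1) fun b _ => lin_homog b
    simpa using this
  have hdh : M.det.IsHomogeneous (∑ j, d j) := by
    rw [Matrix.det_apply]
    refine IsHomogeneous.sum _ _ _ fun σ _ => ?_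
    have h1 : (∏ i, M (σ i) i).IsHomogeneous (∑ j, d j) :=
      IsHomogeneous.prod _ _ _ fun i _ => hd i (σ i)
    rcases Int.units_eq_one_or (Equiv.Perm.sign σ) with hs | hs
    · simpa [hs] using h1
    · rw [hs]; simpa using h1.neg
  have ht : ∑ j, d j = B.card + c.totalDegree := by
    rw [← hdh.totalDegree hdet, hc, totalDegree_mul_of_isDomain hQ0 hc0, hQh.totalDegree hQ0]
  have hct : c.totalDegree = 0 := by omega
  have hcu : IsUnit c := by
    rw [totalDegree_eq_zero_iff_eq_C] at hct
    rw [hct]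
    apply IsUnit.map C
    rw [isUnit_iff_ne_zero]
    intro h0
    rw [h0] at hct
    apply hc0; rw [hct]; simp
  refine ⟨by omega, h, ?_, ?_⟩
  · have := Matrix.linearIndependent_cols_of_det_ne_zero hdet
    exact this
  · apply le_antisymm
    · rw [Submodule.span_le]; rintro _ ⟨j, rfl⟩; exact h j
    · intro ψ hψ
      have hdv : ∀ j, Q ∣ M.cramer ψ j := by
        intro j
        rw [Matrix.cramer_apply]
        have := prod_dvd_det hB hinj (Function.update η j ψ) (by
          intro i
          by_cases hi : i = j
          · subst hi; simpa using hψ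
          · simpa [hi] using h i)
        convert this using 2
        ext1 a b
        by_cases hb : b = j
        · subst hb; simp [hM]
        · simp [hM, hb]
      choose q hq using hdv
      obtain ⟨u, rfl⟩ := hcu
      have h1 := Matrix.mulVec_cramer M ψ
      have h2 : ψ = ∑ j, ((↑u⁻¹ : S K m) * q j) • η j := by
        ext1 i
        have h3 := congrFun h1 i
        simp only [Matrix.mulVec, dotProduct, Pi.smul_apply, smul_eq_mul, hq, hc] at h3
        have h4 : Q * ∑ j, q j * η j i = Q * (u * ψ i) := by
          rw [Finset.mul_sum, ← mul_assoc, ← h3]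
          refine Finset.sum_congr rfl fun j _ => ?_
          simp only [hM, Matrix.of_apply]; ring
        have h5 := mul_left_cancel₀ hQ0 h4
        simp only [Finset.sum_apply, Pi.smul_apply, smul_eq_mul, mul_assoc]
        rw [← Finset.mul_sum, h5, Units.inv_mul_cancel_left]
      rw [h2]
      exact Submodule.sum_mem _ fun j _ => Submodule.smul_mem _ _ (Submodule.subset_span ⟨j, rfl⟩)

end Saito

section Select

lemma select {F : Type*} [Field F] {n s : ℕ} (u : Option (Fin s ⊕ Fin n) → (Fin (n + 1) → F))
    (hspan : Submodule.span F (Set.range u) = ⊤) (h0 : u none ≠ 0) :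
    ∃ σ : Fin n → Fin s ⊕ Fin n, (∀ j, σ j = Sum.inr j ∨ ∃ i, σ j = Sum.inl i) ∧
      LinearIndependent F
        (fun i : Fin (n + 1) => u ((Fin.cons none (fun j => some (σ j)) :
          Fin (n + 1) → Option (Fin s ⊕ Fin n)) i)) := by
  have hs : LinearIndepOn F u {none} := by
    rw [linearIndepOn_singleton_iff]; exact h0
  obtain ⟨T, -, hT0, hTs, hTi⟩ := exists_linearIndepOn_extension hs (Set.subset_univ _)
  have hTs' : Submodule.span F (Set.range fun x : T => u x) = ⊤ := by
    rw [eq_top_iff, ← hspan, Submodule.span_le, ← Set.image_univ]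
    have hr : (Set.range fun x : T => u x) = u '' T := by
      ext y; simp [Set.mem_image]
    rw [hr]; exact hTs
  have hcard : Fintype.card T = n + 1 := by
    have h1 := finrank_span_eq_card (R := F) (b := fun x : T => u x) hTi
    rw [hTs', finrank_top] at h1
    simpa using h1.symm
  have hnone : none ∈ T := hT0 rfl
  set I0 : Finset (Fin s) := Finset.univ.filter fun i => some (Sum.inl i) ∈ T with hI0
  set J : Finset (Fin n) := Finset.univ.filter fun i => some (Sum.inr i) ∈ T with hJ
  have hTeq : T.toFinset = Finset.insertNone (I0.disjSum J) := by
    ext x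
    rcases x with _ | (i | j)
    · simp [hnone]
    · simp [hI0]
    · simp [hJ]
  have hc2 : I0.card + J.card = n := by
    have := congrArg Finset.card hTeq
    rw [Set.toFinset_card, hcard, Finset.card_insertNone, Finset.card_disjSum] at this
    omega
  have hc3 : (Jᶜ).card = I0.card := by
    rw [Finset.card_compl, Fintype.card_fin]; omega
  let E := Finset.equivOfCardEq hc3
  let σ : Fin n → Fin s ⊕ Fin n := fun j =>
    if h : j ∈ J then Sum.inr j else Sum.inl (E ⟨j, by simpa using h⟩)
  have hσin : ∀ j, j ∈ J → σ j = Sum.inr j := fun j h => by simp [σ, h]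
  have hσout : ∀ j (h : j ∉ J), σ j = Sum.inl ((E ⟨j, by simpa using h⟩ : I0) : Fin s) :=
    fun j h => by simp [σ, h]
  have hσinj : Function.Injective σ := by
    intro a b hab
    by_cases ha : a ∈ J <;> by_cases hb : b ∈ J
    · rw [hσin a ha, hσin b hb] at hab; simpa using hab
    · rw [hσin a ha, hσout b hb] at hab; simp at hab
    · rw [hσout a ha, hσin b hb] at hab; simp at hab
    · rw [hσout a ha, hσout b hb] at hab
      have := E.injective (Subtype.ext (Sum.inl.inj hab))
      simpa using this
  have hσT : ∀ j, some (σ j) ∈ T := by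
    intro j
    by_cases hj : j ∈ J
    · rw [hσin j hj]; simpa [hJ] using hj
    · rw [hσout j hj]
      have := (E ⟨j, by simpa using hj⟩).2
      exact (Finset.mem_filter.mp this).2
  refine ⟨σ, ?_, ?_⟩
  · intro j
    by_cases hj : j ∈ J
    · exact Or.inl (hσin j hj)
    · exact Or.inr ⟨_, hσout j hj⟩
  · have hmem : ∀ i, (Fin.cons none (fun j => some (σ j)) :
        Fin (n + 1) → Option (Fin s ⊕ Fin n)) i ∈ T := by
      intro i
      refine Fin.cases ?_ (fun j => ?_) i
      · simpa using hnone
      · simpa using hσT j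
    have hinj : Function.Injective (fun i : Fin (n + 1) => (⟨_, hmem i⟩ : T)) := by
      intro a b hab
      have hab' := congrArg Subtype.val hab
      revert hab'
      refine Fin.cases ?_ (fun a => ?_) a <;> refine Fin.cases ?_ (fun b => ?_) b
      · simp
      · simp
      · simp
      · simp only [Fin.cons_succ, Option.some.injEq, Fin.succ_inj]
        intro h; exact hσinj h
    exact LinearIndependent.comp hTi _ hinj

end Select

section Restrict
variable {K : Type*} [Field K] {ℓ m : ℕ}

/-- Pullback of a linear form. -/
def pb (ι : (Fin m → K) →ₗ[K] (Fin ℓ → K)) (β : Fin ℓ → K) : Fin m → K :=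
  fun i => ∑ j, β j * ι (Pi.single i 1) j

lemma pb_pair (ι : (Fin m → K) →ₗ[K] (Fin ℓ → K)) (β : Fin ℓ → K) (w : Fin m → K) :
    ∑ i, pb ι β i * w i = ∑ j, β j * ι w j := by
  have h : ∀ j, ι w j = ∑ i, w i * ι (Pi.single i 1) j := by
    intro j
    conv_lhs => rw [pi_eq_sum_univ' w]
    simp [Finset.sum_apply, map_sum, map_smul]
  simp only [h, pb, Finset.sum_mul, Finset.mul_sum]
  rw [Finset.sum_comm]
  exact Finset.sum_congr rfl fun i _ => Finset.sum_congr rfl fun j _ => by ring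

lemma pullback_lin (ι : (Fin m → K) →ₗ[K] (Fin ℓ → K)) (β : Fin ℓ → K) :
    pullback ι (lin β) = lin (pb ι β) := by
  simp only [pullback, lin, pb, map_sum, map_mul, aeval_X, aeval_C, algebraMap_eq,
    Finset.mul_sum, Finset.sum_mul]
  rw [Finset.sum_comm]
  exact Finset.sum_congr rfl fun i _ => Finset.sum_congr rfl fun j _ => by ring

lemma hyp_pb (ι : (Fin m → K) →ₗ[K] (Fin ℓ → K)) (β : Fin ℓ → K) :
    hyp (pb ι β) = (hyp β).comap ι := by
  ext w
  rw [Submodule.mem_comap, mem_hyp, mem_hyp, pb_pair]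

lemma map_hyp_pb (ι : (Fin m → K) →ₗ[K] (Fin ℓ → K)) (β : Fin ℓ → K) :
    (hyp (pb ι β)).map ι = LinearMap.range ι ⊓ hyp β := by
  rw [hyp_pb, Submodule.map_comap_eq]

lemma pb_eq_zero_iff (ι : (Fin m → K) →ₗ[K] (Fin ℓ → K)) (β : Fin ℓ → K) :
    pb ι β = 0 ↔ LinearMap.range ι ≤ hyp β := by
  constructor
  · rintro h _ ⟨w, rfl⟩
    rw [mem_hyp, ← pb_pair, h]; simp
  · intro h
    ext i
    have := h ⟨Pi.single i 1, rfl⟩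
    rw [mem_hyp] at this
    exact this

/-- `applyD` as a linear map in the form. -/
noncomputable def appF (θ : Deriv K ℓ) : (Fin ℓ → K) →ₗ[K] S K ℓ where
  toFun α := applyD θ α
  map_add' a b := by simp [applyD, add_mul, Finset.sum_add_distrib]
  map_smul' c a := by
    simp only [applyD, Pi.smul_apply, smul_eq_mul, map_mul, RingHom.id_apply, smul_eq_C_mul,
      Finset.mul_sum, mul_assoc]

lemma pullback_applyD_eq_zero (ι : (Fin m → K) →ₗ[K] (Fin ℓ → K)) {A bs : Finset (Fin ℓ → K)}
    (hbs : bs ⊆ A) (hι : LinearMap.range ι = bs.inf hyp) {θ : Deriv K ℓ} (hθ : θ ∈ logDer A)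
    {δ : Fin ℓ → K} (hδ : LinearMap.range ι ≤ hyp δ) : pullback ι (applyD θ δ) = 0 := by
  have h1 : (⨅ a : bs, LinearMap.ker (∑ i, (a : Fin ℓ → K) i • LinearMap.proj i :
      (Fin ℓ → K) →ₗ[K] K)) ≤ LinearMap.ker (∑ i, δ i • LinearMap.proj i :
      (Fin ℓ → K) →ₗ[K] K) := by
    refine le_trans ?_ hδ
    rw [hι, Finset.inf_eq_iInf, iInf_subtype]
    exact le_rfl
  have h2 := mem_span_of_iInf_ker_le_ker h1
  rw [Submodule.mem_span_range_iff_exists_fun] at h2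
  obtain ⟨c, hc⟩ := h2
  have h3 : δ = ∑ a : bs, c a • (a : Fin ℓ → K) := by
    ext j
    have := LinearMap.congr_fun hc (Pi.single j 1)
    simp [LinearMap.sum_apply, Pi.single_apply] at this
    rw [← this]; simp [Finset.sum_apply]
  have h4 : applyD θ δ = ∑ a : bs, c a • applyD θ (a : Fin ℓ → K) := by
    change appF θ δ = ∑ a : bs, c a • appF θ (a : Fin ℓ → K)
    conv_lhs => rw [h3]
    simp only [map_sum, map_smul]
  rw [h4, map_sum]
  refine Finset.sum_eq_zero fun a _ => ?_
  obtain ⟨q, hq⟩ := hθ a (hbs a.2)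
  have h5 : pb ι (a : Fin ℓ → K) = 0 := by
    rw [pb_eq_zero_iff, hι]; exact Finset.inf_le a.2
  rw [map_smul, hq, map_mul, pullback_lin, h5]
  simp [lin]

lemma restD_dvd (ι : (Fin m → K) →ₗ[K] (Fin ℓ → K)) (r : (Fin ℓ → K) →ₗ[K] (Fin m → K))
    (hr : ∀ w, r (ι w) = w) {A bs : Finset (Fin ℓ → K)}
    (hbs : bs ⊆ A) (hι : LinearMap.range ι = bs.inf hyp) {θ : Deriv K ℓ} (hθ : θ ∈ logDer A)
    {β : Fin ℓ → K} (hβ : β ∈ A) :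
    lin (pb ι β) ∣ applyD (restD ι (fun i j => r (Pi.single j 1) i) θ) (pb ι β) := by
  set γ : Fin m → Fin ℓ → K := fun i j => r (Pi.single j 1) i with hγ
  have hγv : ∀ i v, ∑ j, γ i j * v j = r v i := by
    intro i v
    have := pb_pair r (Pi.single i 1) v
    simpa [pb, Pi.single_apply, hγ] using this
  have h1 : applyD (restD ι γ θ) (pb ι β) = pullback ι (applyD θ (∑ i, pb ι β i • γ i)) := by
    have : applyD θ (∑ i, pb ι β i • γ i) = ∑ i, pb ι β i • applyD θ (γ i) := by
      change appF θ (∑ i, pb ι β i • γ i) = ∑ i, pb ι β i • appF θ (γ i)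
      simp only [map_sum, map_smul]
    rw [this, map_sum]
    simp only [smul_eq_C_mul, map_mul, pullback, aeval_C, algebraMap_eq]
    rfl
  have h2 : applyD θ (∑ i, pb ι β i • γ i) =
      applyD θ (∑ i, pb ι β i • γ i - β) + applyD θ β := by
    change appF θ (∑ i, pb ι β i • γ i) = appF θ (∑ i, pb ι β i • γ i - β) + appF θ β
    rw [map_sub, sub_add_cancel]
  rw [h1, h2, map_add, pullback_applyD_eq_zero ι hbs hι hθ, zero_add, ← pullback_lin]
  · exact map_dvd _ (hθ β hβ)
  · rintro _ ⟨w, rfl⟩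
    rw [mem_hyp]
    simp only [Pi.sub_apply, Finset.sum_apply, Pi.smul_apply, smul_eq_mul, sub_mul,
      Finset.sum_sub_distrib, Finset.sum_mul]
    rw [Finset.sum_comm]
    simp only [mul_assoc, ← Finset.mul_sum, hγv, hr, pb_pair, sub_self]

lemma restD_add (ι : (Fin m → K) →ₗ[K] (Fin ℓ → K)) (γ) (θ η : Deriv K ℓ) :
    restD ι γ (θ + η) = restD ι γ θ + restD ι γ η := by
  ext1 i; simp [restD, applyD_add]

lemma restD_smul (ι : (Fin m → K) →ₗ[K] (Fin ℓ → K)) (γ) (f : S K ℓ) (θ : Deriv K ℓ) :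
    restD ι γ (f • θ) = pullback ι f • restD ι γ θ := by
  ext1 i; simp [restD, applyD_smul]

lemma restD_homog (ι : (Fin m → K) →ₗ[K] (Fin ℓ → K)) (γ) {θ : Deriv K ℓ} {d : ℕ}
    (h : IsHomog θ d) : IsHomog (restD ι γ θ) d := by
  intro i
  have h1 : (applyD θ (γ i)).IsHomogeneous d :=
    IsHomogeneous.sum _ _ _ fun j _ => (h j).C_mul _
  have := h1.aeval (n := 1) (fun j => ∑ i, C (ι (Pi.single i 1) j) * X i : Fin ℓ → S K m)
    (fun j => IsHomogeneous.sum _ _ _ fun i _ => isHomogeneous_C_mul_X _ _)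
  simpa [restD, pullback] using this

end Restrict

section Core
variable {K : Type*} [Field K] {ℓ : ℕ}

lemma core {n m : ℕ} (hm : m = n + 1)
    (A : Finset (Fin ℓ → K)) 
    (s : ℕ) (θ : Fin s → Deriv K ℓ) (φ : Fin n → Deriv K ℓ)
    (d : Fin s → ℕ) (e : Fin n → ℕ)
    (hθhom : ∀ i, IsHomog (θ i) (d i)) (hφhom : ∀ j, IsHomog (φ j) (e j))
    (hde : ∀ (i : Fin s) (j : Fin n), d i ≤ e j)
    (hgen : Submodule.span (S K ℓ)
        ({eulerD K ℓ} ∪ Set.range θ ∪ Set.range φ) = logDer A)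
    (Xs : Submodule K (Fin ℓ → K)) (hX : ∃ b ⊆ A, Xs = b.inf hyp)
    (hdim : Module.finrank K Xs = m)
    (hcard : (restArr A Xs).card = 1 + ∑ j, e j)
    (E : Fin m → ℕ) (hE0 : ∀ i : Fin m, (i : ℕ) = 0 → E i = 1)
    (hE1 : ∀ (j : Fin n) (i : Fin m), (i : ℕ) = j + 1 → E i = e j) :
    RestFree A Xs m E := by
  subst hm
  obtain ⟨bs, hbs, hXbs⟩ := hX
  have Φ : (Fin (n + 1) → K) ≃ₗ[K] Xs :=
    LinearEquiv.ofFinrankEq _ _ (by rw [hdim]; simp)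
  set ι : (Fin (n + 1) → K) →ₗ[K] (Fin ℓ → K) := Xs.subtype ∘ₗ Φ.toLinearMap with hιdef
  have hrange : LinearMap.range ι = Xs := by
    rw [hιdef, LinearMap.range_comp, LinearEquiv.range, Submodule.map_top, Submodule.range_subtype]
  have hinjι : Function.Injective ι := by
    intro a b hab
    exact Φ.injective (Subtype.ext hab)
  obtain ⟨r, hr'⟩ := LinearMap.exists_leftInverse_of_injective ι (LinearMap.ker_eq_bot.mpr hinjι)
  have hr : ∀ w, r (ι w) = w := fun w => LinearMap.congr_fun hr' w
  have hsec : ∀ Y : Submodule K (Fin ℓ → K), ∃ b : Fin (n + 1) → K, Y ∈ restArr A Xs →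
      (∃ β ∈ A, b = pb ι β) ∧ b ≠ 0 ∧ (hyp b).map ι = Y := by
    intro Y
    by_cases hY : Y ∈ restArr A Xs
    · obtain ⟨β, hβ, rfl⟩ := Finset.mem_image.mp hY
      rw [Finset.mem_filter] at hβ
      refine ⟨pb ι β, fun _ => ⟨⟨β, hβ.1, rfl⟩, ?_, ?_⟩⟩
      · rw [Ne, pb_eq_zero_iff, hrange]; exact hβ.2
      · rw [map_hyp_pb, hrange]
    · exact ⟨0, fun h => absurd h hY⟩
  choose g hg using hsec
  set B := (restArr A Xs).image g with hB
  have hB0 : ∀ b ∈ B, b ≠ 0 := by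
    intro b hb
    obtain ⟨Y, hY, rfl⟩ := Finset.mem_image.mp hb
    exact (hg Y hY).2.1
  have hBA : ∀ b ∈ B, ∃ β ∈ A, b = pb ι β := by
    intro b hb
    obtain ⟨Y, hY, rfl⟩ := Finset.mem_image.mp hb
    exact (hg Y hY).1
  have hBinj : ∀ b ∈ B, ∀ b' ∈ B, hyp b = hyp b' → b = b' := by
    intro b hb b' hb' h
    obtain ⟨Y, hY, rfl⟩ := Finset.mem_image.mp hb
    obtain ⟨Y', hY', rfl⟩ := Finset.mem_image.mp hb'
    have h1 := (hg Y hY).2.2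
    have h2 := (hg Y' hY').2.2
    rw [h, h2] at h1
    rw [h1]
  have hBcard : B.card = (restArr A Xs).card := by
    apply Finset.card_image_of_injOn
    intro Y hY Y' hY' h
    have h1 := (hg Y hY).2.2
    have h2 := (hg Y' hY').2.2
    rw [h, h2] at h1
    exact h1.symm
  have hBrep : Represents B ι A Xs := by
    refine ⟨hB0, ?_, hBcard⟩
    rw [hB, Finset.image_image]
    conv_rhs => rw [← Finset.image_id (s := restArr A Xs)]
    exact Finset.image_congr fun Y hY => (hg Y hY).2.2
  refine ⟨Φ, B, hBrep, ?_⟩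
  set γ : Fin (n + 1) → Fin ℓ → K := fun i j => r (Pi.single j 1) i with hγ
  have hγv : ∀ i v, ∑ j, γ i j * v j = r v i := by
    intro i v
    have := pb_pair r (Pi.single i 1) v
    simpa [pb, Pi.single_apply, hγ] using this
  have hres : ∀ η ∈ logDer A, restD ι γ η ∈ logDer B := by
    intro η hη b hb
    obtain ⟨β, hβ, rfl⟩ := hBA b hb
    exact restD_dvd ι r hr hbs (hrange.trans hXbs) hη hβ
  let G : Option (Fin s ⊕ Fin n) → Deriv K ℓ := fun x =>
    x.elim (eulerD K ℓ) (Sum.elim θ φ)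
  let D : Option (Fin s ⊕ Fin n) → ℕ := fun x => x.elim 1 (Sum.elim d e)
  have hGmem : ∀ x, G x ∈ logDer A := by
    intro x
    rw [← hgen]
    apply Submodule.subset_span
    rcases x with _ | (i | j)
    · left; left; rfl
    · left; right; exact ⟨i, rfl⟩
    · right; exact ⟨j, rfl⟩
  have hGhom : ∀ x, IsHomog (G x) (D x) := by
    rintro (_ | (i | j))
    · intro i; exact isHomogeneous_X _ _
    · exact hθhom i
    · exact hφhom j
  have hGspan : Submodule.span (S K ℓ) (Set.range G) = logDer A := by
    rw [← hgen]
    congr 1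
    ext η
    simp [G, Option.exists, Sum.exists, eq_comm, or_assoc]
  let F := FractionRing (S K (n + 1))
  let toF : Deriv K (n + 1) → (Fin (n + 1) → F) := fun η i => algebraMap (S K (n + 1)) F (η i)
  let u : Option (Fin s ⊕ Fin n) → (Fin (n + 1) → F) := fun x => toF (restD ι γ (G x))
  have halg : Function.Injective (algebraMap (S K (n + 1)) F) := IsFractionRing.injective _ _
  have hmemspan : ∀ η ∈ logDer A, toF (restD ι γ η) ∈ Submodule.span F (Set.range u) := by
    intro η hη
    rw [← hGspan] at hη
    induction hη using Submodule.span_induction with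
    | mem x hx =>
      obtain ⟨y, rfl⟩ := hx
      exact Submodule.subset_span ⟨y, rfl⟩
    | zero =>
      convert Submodule.zero_mem _
      ext i; simp [toF, restD, applyD]
    | add x y _ _ hx hy =>
      convert Submodule.add_mem _ hx hy using 1
      ext i; simp [toF, restD_add]
    | smul a x _ hx =>
      convert Submodule.smul_mem _ (algebraMap (S K (n + 1)) F (pullback ι a)) hx using 1
      ext i; simp [toF, restD_smul]
  set Q : S K ℓ := ∏ β ∈ A.filter (fun β => ¬ Xs ≤ hyp β), lin β with hQ
  have hpQ : pullback ι Q ≠ 0 := by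
    rw [hQ, map_prod, Finset.prod_ne_zero_iff]
    intro β hβ
    rw [Finset.mem_filter] at hβ
    rw [pullback_lin]
    apply lin_ne_zero
    rw [Ne, pb_eq_zero_iff, hrange]; exact hβ.2
  have hspan : Submodule.span F (Set.range u) = ⊤ := by
    rw [eq_top_iff, ← (Pi.basisFun F (Fin (n + 1))).span_eq, Submodule.span_le]
    rintro _ ⟨i, rfl⟩
    have hη : (Q • (fun j => C (ι (Pi.single i 1) j)) : Deriv K ℓ) ∈ logDer A := by
      intro α hα
      rw [applyD_smul]
      by_cases h : Xs ≤ hyp α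
      · have h1 : ι (Pi.single i 1) ∈ hyp α := h (hrange ▸ ⟨_, rfl⟩)
        rw [mem_hyp] at h1
        have h2 : applyD (fun j => C (ι (Pi.single i 1) j) : Deriv K ℓ) α = 0 := by
          simp only [applyD, ← map_mul, ← map_sum, h1, map_zero]
        rw [h2, mul_zero]; exact dvd_zero _
      · apply Dvd.dvd.mul_right
        exact Finset.dvd_prod_of_mem _ (Finset.mem_filter.mpr ⟨hα, h⟩)
    have h1 := hmemspan _ hη
    have hne : algebraMap (S K (n + 1)) F (pullback ι Q) ≠ 0 := by
      rw [Ne, map_eq_zero_iff _ halg]; exact hpQ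
    have h2 := Submodule.smul_mem _ (algebraMap (S K (n + 1)) F (pullback ι Q))⁻¹ h1
    rw [SetLike.mem_coe]
    convert h2 using 1
    ext i'
    have h3 : applyD (fun j => C (ι (Pi.single i 1) j) : Deriv K ℓ) (γ i') =
        C ((Pi.single i 1 : Fin (n + 1) → K) i') := by
      simp only [applyD, ← map_mul, ← map_sum, hγv, hr]
    have h4 : restD ι γ (Q • (fun j => C (ι (Pi.single i 1) j)) : Deriv K ℓ) i' =
        pullback ι Q * C ((Pi.single i 1 : Fin (n + 1) → K) i') := by
      rw [restD_smul, Pi.smul_apply, smul_eq_mul]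
      congr 1
      simp only [restD, h3, pullback, aeval_C, algebraMap_eq]
    simp only [Pi.smul_apply, smul_eq_mul, toF, h4, map_mul]
    rw [inv_mul_cancel_left₀ hne]
    by_cases hi : i' = i
    · subst hi; simp
    · simp [Pi.single_apply, hi]
  have hnone : u none ≠ 0 := by
    intro h0
    have h1 := congrFun h0 0
    simp only [u, toF, Pi.zero_apply, map_eq_zero_iff _ halg] at h1
    have h2 : restD ι γ (G none) 0 = lin (pb ι (γ 0)) := by
      rw [← pullback_lin]; rfl
    rw [h2] at h1
    refine lin_ne_zero ?_ h1
    intro h3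
    have h4 := congrFun h3 0
    simp [pb, hγv, hr] at h4
  obtain ⟨σ, hσ, hli⟩ := select u hspan hnone
  set τ : Fin (n + 1) → Option (Fin s ⊕ Fin n) := Fin.cons none (fun j => some (σ j)) with hτ
  have hdet : (Matrix.of fun i j => restD ι γ (G (τ j)) i :
      Matrix (Fin (n + 1)) (Fin (n + 1)) (S K (n + 1))).det ≠ 0 := by
    set M := (Matrix.of fun i j => restD ι γ (G (τ j)) i :
      Matrix (Fin (n + 1)) (Fin (n + 1)) (S K (n + 1))) with hM
    have h1 : IsUnit (M.map (algebraMap (S K (n + 1)) F)) := by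
      rw [← Matrix.linearIndependent_cols_iff_isUnit]
      exact hli
    rw [Matrix.isUnit_iff_isUnit_det, isUnit_iff_ne_zero] at h1
    intro h0
    apply h1
    have := RingHom.map_det (algebraMap (S K (n + 1)) F) M
    rw [h0, map_zero] at this
    exact this.symm
  have hle : ∀ j, D (some (σ j)) ≤ e j := by
    intro j
    rcases hσ j with h | ⟨i, h⟩
    · rw [h]; exact le_rfl
    · rw [h]; exact hde i j
  have hsum : ∑ i, D (τ i) = 1 + ∑ j, D (some (σ j)) := by
    rw [Fin.sum_univ_succ]; simp [hτ, D]
  have hsumle : ∑ j, D (some (σ j)) ≤ ∑ j, e j := Finset.sum_le_sum fun j _ => hle j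
  obtain ⟨hdeg, hbasis⟩ := saito hB0 hBinj (fun j => restD ι γ (G (τ j)))
    (fun j => hres _ (hGmem _)) (fun j => D (τ j)) (fun j => restD_homog ι γ (hGhom _)) hdet
    (by rw [hsum, hBcard, hcard]; omega)
  have heq : ∀ j, D (some (σ j)) = e j := by
    have h1 : ∑ j, D (some (σ j)) = ∑ j, e j := by
      rw [hsum, hBcard, hcard] at hdeg; omega
    have h2 := (Finset.sum_eq_sum_iff_of_le fun j _ => hle j).mp h1
    exact fun j => h2 j (Finset.mem_univ j)
  refine ⟨_, hbasis, ?_⟩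
  intro i
  have h := restD_homog ι γ (hGhom (τ i))
  have hEi : E i = D (τ i) := by
    refine Fin.cases ?_ (fun j => ?_) i
    · rw [hE0 0 rfl]; rfl
    · rw [hE1 j j.succ (by simp)]; exact (heq j).symm
  rw [hEi]; exact h

end Core

end ArrPaper

open ArrPaper in
/-- a restriction theorem from a generating set of `D(𝒜)`. -/
theorem stmt9 {K : Type*} [Field K] {ℓ k : ℕ} (hk : k < ℓ)
    (A : Finset (Fin ℓ → K)) (hA0 : ∀ α ∈ A, α ≠ 0)
    (s : ℕ) (θ : Fin s → Deriv K ℓ) (φ : Fin (ℓ - k - 1) → Deriv K ℓ)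
    (d : Fin s → ℕ) (e : Fin (ℓ - k - 1) → ℕ)
    (hθhom : ∀ i, IsHomog (θ i) (d i)) (hφhom : ∀ j, IsHomog (φ j) (e j))
    (hθmem : ∀ i, θ i ∈ logDer A) (hφmem : ∀ j, φ j ∈ logDer A)
    (hdmono : ∀ i i' : Fin s, i ≤ i' → d i ≤ d i')
    (hde : ∀ (i : Fin s) (j : Fin (ℓ - k - 1)), d i ≤ e j)
    (hgen : Submodule.span (S K ℓ)
        ({eulerD K ℓ} ∪ Set.range θ ∪ Set.range φ) = logDer A)
    (Xs : Submodule K (Fin ℓ → K)) (hX : ∃ b ⊆ A, Xs = b.inf hyp)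
    (hcodim : codim Xs = k)
    (hcard : (restArr A Xs).card = 1 + ∑ j, e j) :
    RestFree A Xs (ℓ - k) (fun i => if h : (i : ℕ) = 0 then 1
      else e ⟨(i : ℕ) - 1, by have := i.isLt; omega⟩) := by
  have hfr : Module.finrank K Xs ≤ ℓ := by
    have := Submodule.finrank_le Xs
    simpa using this
  have hdim : Module.finrank K Xs = ℓ - k := by
    unfold codim at hcodim; omega
  refine core (n := ℓ - k - 1) (m := ℓ - k) (by omega) A s θ φ d e hθhom hφhom hde hgen Xs hX
    hdim hcard _ ?_ ?_
  · intro i hi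
    simp [hi]
  · intro j i hi
    have h0 : (i : ℕ) ≠ 0 := by omega
    simp only [h0, dif_neg, not_false_eq_true]
    congr 1
    ext
    simp [hi]
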